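/- arXiv:1909.08559 — 2 statements merged into one kernel-verified Lean document; each statement's English description precedes it below -/
import Mathlib

section
/- The full logic SLL lacks the finite model property and its satisfiability problem is undecidable: (i) there exists a formula of L that is satisfiable with respect to 𝔐• but has only infinite models; and (ii) taking atoms indexed by natural numbers so that formulas of L form an encodable type, the set of L-formulas satisfiable with respect to 𝔐• is not a decidable (computable) predicate. -/
attribute [local instance] Classical.propDecidable

/-- Formulas of the modal logic of supervised learning (SLL), with atoms indexed by ℕ. -/
inductive Form : Type
  | atom : ℕ → Form
  | neg : Form → Form
  | and : Form → Form → Form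
  | dia : Form → Form   -- ♦
  | rem1 : Form → Form  -- ⟨-⟩₁
  | rem2 : Form → Form  -- ⟨-⟩₂
  | add : Form → Form   -- ⟨+⟩

namespace Form

def or (φ ψ : Form) : Form := .neg ((Form.neg φ).and (Form.neg ψ))
def imp (φ ψ : Form) : Form := Form.or (.neg φ) ψ
def bot : Form := (Form.atom 0).and (.neg (.atom 0))
def top : Form := .neg bot
def box (φ : Form) : Form := .neg (.dia (.neg φ))      -- ■
def boxr1 (φ : Form) : Form := .neg (.rem1 (.neg φ))   -- [-]₁
def boxr2 (φ : Form) : Form := .neg (.rem2 (.neg φ))   -- [-]₂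
def boxadd (φ : Form) : Form := .neg (.add (.neg φ))   -- [+]

end Form

/-- A model of SLL. -/
structure SLLModel (W : Type) where
  R1 : Set (W × W)
  R2 : Set (W × W)
  V : ℕ → Set W

namespace SLLModel
variable {W : Type}

/-- M ⊖ e : delete edge `e` from R₁. -/
def del (M : SLLModel W) (e : W × W) : SLLModel W := { M with R1 := M.R1 \ {e} }

/-- M ⊕ e : add edge `e` to R₁. -/
def addE (M : SLLModel W) (e : W × W) : SLLModel W := { M with R1 := insert e M.R1 }

end SLLModel

/-- `edges w h` is Set(S) for the sequence `S` whose *reverse* is `w :: h`;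
i.e. `w = e(S)` is the last element and `h` lists the earlier elements in reverse order. -/
def edges {W : Type} : W → List W → Set (W × W)
  | _, [] => ∅
  | w, y :: t => insert (y, w) (edges y t)

/-- `trunc e w h` is (the reversed representation of) the truncation `S|_e`:
the initial segment of `S` ending at the source of the first occurrence of `e` in `S`. -/
noncomputable def trunc {W : Type} (e : W × W) : W → List W → W × List W
  | w, [] => (w, [])
  | w, y :: t =>
    if e ∈ edges y t then trunc e y t
    else if (y, w) = e then (y, t)
    else (w, y :: t)

/-- Truth of an SLL-formula at a pointed model: the evaluation sequence `S` is
represented in reverse as `w :: h` with `w = e(S)`. -/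
def Sat {W : Type} : SLLModel W → Form → W → List W → Prop
  | M, .atom n, w, _ => w ∈ M.V n
  | M, .neg φ, w, h => ¬ Sat M φ w h
  | M, .and φ ψ, w, h => Sat M φ w h ∧ Sat M ψ w h
  | M, .dia φ, w, h => ∃ v, (w, v) ∈ M.R1 ∧ Sat M φ v (w :: h)
  | M, .rem1 φ, w, h => ∃ e, e ∈ edges w h ∧ e ∉ M.R2 ∧
      Sat (M.del e) φ (trunc e w h).1 (trunc e w h).2
  | M, .rem2 φ, w, h => ∃ e, e ∈ M.R1 ∧ e ∉ M.R2 ∧ e ∉ edges w h ∧ Sat (M.del e) φ w h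
  | M, .add φ, w, h => ∃ e, e ∈ M.R2 ∧ e ∉ M.R1 ∧ Sat (M.addE e) φ w h

/-- An injective numerical coding of formulas. -/
def Form.encode : Form → ℕ
  | .atom n => Nat.pair 0 n
  | .neg φ => Nat.pair 1 φ.encode
  | .and φ ψ => Nat.pair 2 (Nat.pair φ.encode ψ.encode)
  | .dia φ => Nat.pair 3 φ.encode
  | .rem1 φ => Nat.pair 4 φ.encode
  | .rem2 φ => Nat.pair 5 φ.encode
  | .add φ => Nat.pair 6 φ.encode

/-! ### Injectivity of the coding -/

theorem Form.encode_injective : Function.Injective Form.encode := by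
  intro φ
  induction φ with
  | atom n => intro ψ h; cases ψ <;> simp [Form.encode, Nat.pair_eq_pair] at h ⊢; exact h
  | neg φ ih => intro ψ h; cases ψ <;> simp [Form.encode, Nat.pair_eq_pair] at h ⊢; exact ih h
  | and φ ψ ih1 ih2 =>
    intro χ h
    cases χ <;> simp [Form.encode, Nat.pair_eq_pair] at h ⊢
    exact ⟨ih1 h.1, ih2 h.2⟩
  | dia φ ih => intro ψ h; cases ψ <;> simp [Form.encode, Nat.pair_eq_pair] at h ⊢; exact ih h
  | rem1 φ ih => intro ψ h; cases ψ <;> simp [Form.encode, Nat.pair_eq_pair] at h ⊢; exact ih h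
  | rem2 φ ih => intro ψ h; cases ψ <;> simp [Form.encode, Nat.pair_eq_pair] at h ⊢; exact ih h
  | add φ ih => intro ψ h; cases ψ <;> simp [Form.encode, Nat.pair_eq_pair] at h ⊢; exact ih h

/-! ### Semantics of the derived connectives -/

namespace SLLAux

theorem sat_imp {W : Type} (M : SLLModel W) (φ ψ : Form) (w : W) (h : List W) :
    Sat M (Form.imp φ ψ) w h ↔ (Sat M φ w h → Sat M ψ w h) := by
  simp only [Form.imp, Form.or, Sat]; tauto

theorem sat_box {W : Type} (M : SLLModel W) (φ : Form) (w : W) (h : List W) :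
    Sat M (Form.box φ) w h ↔ ∀ v, (w, v) ∈ M.R1 → Sat M φ v (w :: h) := by
  simp only [Form.box, Sat]; push Not; rfl

theorem sat_boxr2_nil {W : Type} (M : SLLModel W) (φ : Form) (w : W) :
    Sat M (Form.boxr2 φ) w [] ↔ ∀ e, e ∈ M.R1 → e ∉ M.R2 → Sat (M.del e) φ w [] := by
  simp [Form.boxr2, Sat, edges]

theorem sat_rem2_nil {W : Type} (M : SLLModel W) (φ : Form) (w : W) :
    Sat M (Form.rem2 φ) w [] ↔ ∃ e, e ∈ M.R1 ∧ e ∉ M.R2 ∧ Sat (M.del e) φ w [] := by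
  simp [Sat, edges]

/-- Finite conjunction. -/
def conj : List Form → Form
  | [] => Form.top
  | φ :: l => φ.and (conj l)

theorem sat_conj {W : Type} (M : SLLModel W) (l : List Form) (w : W) (h : List W) :
    Sat M (conj l) w h ↔ ∀ φ ∈ l, Sat M φ w h := by
  induction l with
  | nil => simp [conj, Form.top, Form.bot, Sat]
  | cons a l ih => simp [conj, Sat, ih]

/-! ### First-order logic of binary relations, with de Bruijn levels -/

inductive Q : Type
  | B : ℕ → ℕ → ℕ → Q
  | neg : Q → Q
  | and : Q → Q → Q
  | ex : Q → Q

def real {X : Type} (B : ℕ → X → X → Prop) : Q → ℕ → (ℕ → X) → Prop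
  | .B l i j, _, ρ => B l (ρ i) (ρ j)
  | .neg q, n, ρ => ¬ real B q n ρ
  | .and p q, n, ρ => real B p n ρ ∧ real B q n ρ
  | .ex q, n, ρ => ∃ a, real B q (n + 1) (Function.update ρ n a)

/-- Well-scopedness, with at most `K` nested quantifiers. -/
def okQ (K : ℕ) : Q → ℕ → Prop
  | .B _ i j, n => i < n ∧ j < n
  | .neg q, n => okQ K q n
  | .and p q, n => okQ K p n ∧ okQ K q n
  | .ex q, n => n < K ∧ okQ K q (n + 1)

/-- atoms -/
def aD : Form := .atom 0
def aU : Form := .atom 1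
def aM (i : ℕ) : Form := .atom (2 * i + 2)
def aP (l : ℕ) : Form := .atom (2 * l + 3)

/-- "the current world is the value of variable `i`" -/
def isv (i : ℕ) : Form := aD.and (.neg (.dia (aM i)))

def trans : Q → ℕ → Form
  | .B l i j, _ => .dia ((isv i).and (.dia (aU.and ((aP l).and (.dia (isv j))))))
  | .neg q, n => .neg (trans q n)
  | .and p q, n => .and (trans p n) (trans q n)
  | .ex q, n => .rem2 (.and (.dia (isv n)) (trans q (n + 1)))

/-- `d` has exactly one `i`-marker, and the edge to it can be deleted. -/
def Nameable {W : Type} (M : SLLModel W) (i : ℕ) (d m : W) : Prop :=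
  (d, m) ∈ M.R1 ∧ (d, m) ∉ M.R2 ∧ m ∈ M.V (2 * i + 2) ∧
    ∀ m', (d, m') ∈ M.R1 → m' ∈ M.V (2 * i + 2) → m' = m

structure Good {W : Type} (M : SLLModel W) (s : W) (K : ℕ) {X : Type} (f : X → W)
    (B : ℕ → X → X → Prop) (mk : ℕ → X → W) : Prop where
  inj : Function.Injective f
  root : ∀ x, (s, f x) ∈ M.R1
  dom : ∀ x, f x ∈ M.V 0
  nam : ∀ i < K, ∀ x, Nameable M i (f x) (mk i x)
  disj : ∀ d m, (s, d) ∈ M.R1 → d ∈ M.V 0 → (d, m) ∈ M.R1 → ∀ i < K, m ∈ M.V (2 * i + 2) →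
    m ∉ M.V 0 ∧ m ∉ M.V 1 ∧ ∀ j < K, j ≠ i → m ∉ M.V (2 * j + 2)
  compl : ∀ d m, (s, d) ∈ M.R1 → d ∈ M.V 0 → ∀ i < K, Nameable M i d m → ∃ x, f x = d
  ser1 : ∀ d, (s, d) ∈ M.R1 → d ∈ M.V 0 → ∀ i < K, ∃ m, (d, m) ∈ M.R1 ∧ m ∈ M.V (2 * i + 2)
  ser2 : ∀ d u d', (s, d) ∈ M.R1 → d ∈ M.V 0 → (d, u) ∈ M.R1 → u ∈ M.V 1 → (u, d') ∈ M.R1 →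
    d' ∈ M.V 0 → ∀ i < K, ∃ m, (d', m) ∈ M.R1 ∧ m ∈ M.V (2 * i + 2)
  rel : ∀ l x y, B l x y ↔ ∃ u, (f x, u) ∈ M.R1 ∧ u ∈ M.V 1 ∧ u ∈ M.V (2 * l + 3) ∧
    (u, f y) ∈ M.R1

/-- The model in which variables `0, …, n-1` are assigned. -/
def minus {W X : Type} (M : SLLModel W) (f : X → W) (mk : ℕ → X → W) (n : ℕ) (ρ : ℕ → X) :
    SLLModel W :=
  { M with R1 := {e | e ∈ M.R1 ∧ ∀ i < n, e ≠ (f (ρ i), mk i (ρ i))} }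

section
variable {W X : Type} {M : SLLModel W} {s : W} {K : ℕ} {f : X → W}
  {B : ℕ → X → X → Prop} {mk : ℕ → X → W}

theorem minus_zero (ρ : ℕ → X) : minus M f mk 0 ρ = M := by
  simp [minus]

theorem minus_succ (n : ℕ) (ρ : ℕ → X) (a : X) :
    (minus M f mk n ρ).del (f a, mk n a) = minus M f mk (n + 1) (Function.update ρ n a) := by
  simp only [minus, SLLModel.del, SLLModel.mk.injEq, and_true]
  ext e
  simp only [Set.mem_sdiff, Set.mem_ofPred_eq, Set.mem_singleton_iff, Nat.lt_succ_iff_lt_or_eq]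
  constructor
  · rintro ⟨⟨h1, h2⟩, h3⟩
    refine ⟨h1, ?_⟩
    rintro i (hi | rfl)
    · simpa [Function.update_of_ne hi.ne] using h2 i hi
    · simpa using h3
  · rintro ⟨h1, h2⟩
    refine ⟨⟨h1, fun i hi => ?_⟩, ?_⟩
    · simpa [Function.update_of_ne hi.ne] using h2 i (Or.inl hi)
    · simpa using h2 n (Or.inr rfl)

theorem Good.mem_minus (G : Good M s K f B mk) {n : ℕ} (hn : n ≤ K) (ρ : ℕ → X) {a b : W}
    (hb : b ∈ M.V 0 ∨ b ∈ M.V 1) : (a, b) ∈ (minus M f mk n ρ).R1 ↔ (a, b) ∈ M.R1 := by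
  simp only [minus, Set.mem_ofPred_eq, and_iff_left_iff_imp]
  rintro _ i hi h
  simp only [Prod.mk.injEq] at h
  obtain ⟨-, rfl⟩ := h
  have h1 := G.nam i (by omega) (ρ i)
  have h2 := G.disj _ _ (G.root (ρ i)) (G.dom _) h1.1 i (by omega) h1.2.2.1
  tauto

/-- Edges to `j`-markers only vanish when variable `j` is assigned. -/
theorem Good.mem_minus_mark (G : Good M s K f B mk) {n : ℕ} (hn : n ≤ K) (ρ : ℕ → X) {j : ℕ}
    (hj : j < K) {a b : W} (hb : b ∈ M.V (2 * j + 2)) :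
    (a, b) ∈ (minus M f mk n ρ).R1 ↔
      (a, b) ∈ M.R1 ∧ (j < n → (a, b) ≠ (f (ρ j), mk j (ρ j))) := by
  simp only [minus, Set.mem_ofPred_eq]
  constructor
  · rintro ⟨h1, h2⟩
    exact ⟨h1, fun h => h2 j h⟩
  · rintro ⟨h1, h2⟩
    refine ⟨h1, fun i hi h => ?_⟩
    by_cases hij : j = i
    · subst hij; exact h2 hi h
    · simp only [Prod.mk.injEq] at h
      obtain ⟨-, rfl⟩ := h
      have h1 := G.nam i (by omega) (ρ i)
      have h2 := G.disj _ _ (G.root (ρ i)) (G.dom _) h1.1 i (by omega) h1.2.2.1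
      exact h2.2.2 j hj hij hb

theorem Good.isv_iff (G : Good M s K f B mk) {n : ℕ} (hn : n ≤ K) (ρ : ℕ → X) {i : ℕ}
    (hi : i < n) (d : W) (h : List W)
    (hd : ∃ m, (d, m) ∈ M.R1 ∧ m ∈ M.V (2 * i + 2)) :
    Sat (minus M f mk n ρ) (isv i) d h ↔ d = f (ρ i) := by
  simp only [isv, aD, aM, Sat]
  constructor
  · rintro ⟨-, h2⟩
    obtain ⟨m, hm, hm'⟩ := hd
    by_contra hne
    apply h2
    refine ⟨m, (G.mem_minus_mark hn ρ (by omega) hm').2 ⟨hm, fun _ h => ?_⟩, hm'⟩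
    simp only [Prod.mk.injEq] at h
    exact hne h.1
  · rintro rfl
    refine ⟨G.dom _, ?_⟩
    rintro ⟨m, hm, hm'⟩
    have hm' : m ∈ M.V (2 * i + 2) := hm'
    rw [G.mem_minus_mark hn ρ (by omega) hm'] at hm
    exact hm.2 hi (by rw [(G.nam i (by omega) (ρ i)).2.2.2 m hm.1 hm'])

theorem Good.sat_trans (G : Good M s K f B mk) (q : Q) : ∀ (n : ℕ) (_ : n ≤ K) (ρ : ℕ → X),
    okQ K q n → (Sat (minus M f mk n ρ) (trans q n) s [] ↔ real B q n ρ) := by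
  induction q with
  | B l i j =>
    rintro n hn ρ ⟨hi, hj⟩
    simp only [trans, real, G.rel]
    constructor
    · rintro ⟨d, h1, h2, u, h3, h4, h5, d', h6, h7⟩
      have hd : d ∈ M.V 0 := h2.1
      have hu : u ∈ M.V 1 := h4
      have hd' : d' ∈ M.V 0 := h7.1
      rw [G.mem_minus hn ρ (Or.inl hd)] at h1
      rw [G.mem_minus hn ρ (Or.inr hu)] at h3
      rw [G.mem_minus hn ρ (Or.inl hd')] at h6
      rw [G.isv_iff hn ρ hi d _ (G.ser1 d h1 hd i (by omega))] at h2
      rw [G.isv_iff hn ρ hj d' _ (G.ser2 d u d' h1 hd h3 hu h6 hd' j (by omega))] at h7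
      subst h2 h7
      exact ⟨u, h3, hu, h5, h6⟩
    · rintro ⟨u, h1, h2, h3, h4⟩
      refine ⟨f (ρ i), (G.mem_minus hn ρ (Or.inl (G.dom _))).2 (G.root _), ?_, u,
        (G.mem_minus hn ρ (Or.inr h2)).2 h1, h2, h3, f (ρ j),
        (G.mem_minus hn ρ (Or.inl (G.dom _))).2 h4, ?_⟩
      · exact (G.isv_iff hn ρ hi _ _ (G.ser1 _ (G.root _) (G.dom _) i (by omega))).2 rfl
      · exact (G.isv_iff hn ρ hj _ _ (G.ser1 _ (G.root _) (G.dom _) j (by omega))).2 rfl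
  | neg q ih => intro n hn ρ ok; simp only [trans, real, Sat, ih n hn ρ ok]
  | and p q ih1 ih2 =>
    intro n hn ρ ok; simp only [trans, real, Sat, ih1 n hn ρ ok.1, ih2 n hn ρ ok.2]
  | ex q ih =>
    rintro n hn ρ ⟨hnK, ok⟩
    simp only [trans, real, sat_rem2_nil]
    constructor
    · rintro ⟨e, h1, h2, h3, h4⟩
      obtain ⟨d, hd0, hd2, hd3⟩ := h3
      have hdV : d ∈ M.V 0 := hd2
      have hd1 : (s, d) ∈ M.R1 := hd0.1.1
      have key : ∀ m, (d, m) ∈ M.R1 → m ∈ M.V (2 * n + 2) → (d, m) = e := by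
        intro m hm hm'
        by_contra hne
        apply hd3
        refine ⟨m, ⟨(G.mem_minus_mark hn ρ hnK hm').2 ⟨hm, by omega⟩, hne⟩, hm'⟩
      obtain ⟨m, hm, hm'⟩ := G.ser1 d hd1 hdV n hnK
      have he := key m hm hm'
      subst he
      have hN : Nameable M n d m := ⟨hm, h2, hm', fun m' k1 k2 => by
        have := key m' k1 k2
        simpa using this⟩
      obtain ⟨x, rfl⟩ := G.compl d m hd1 hdV n hnK hN
      have : m = mk n x := (G.nam n hnK x).2.2.2 m hm hm'
      subst this
      rw [minus_succ, ih (n + 1) hnK _ ok] at h4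
      exact ⟨x, h4⟩
    · rintro ⟨x, hx⟩
      obtain ⟨k1, k2, k3, k4⟩ := G.nam n hnK x
      refine ⟨(f x, mk n x), (G.mem_minus_mark hn ρ hnK k3).2 ⟨k1, by omega⟩, k2, ?_⟩
      rw [minus_succ]
      refine ⟨⟨f x, (G.mem_minus hnK _ (Or.inl (G.dom _))).2 (G.root _), ?_⟩,
        (ih (n + 1) hnK _ ok).2 hx⟩
      exact (G.isv_iff hnK _ (Nat.lt_succ_self n) _ _
        (G.ser1 _ (G.root _) (G.dom _) n hnK)).2 (by simp)

end

/-! ### The formula expressing goodness -/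

def goodForm (K : ℕ) : Form :=
  Form.and (.rem2 (.dia (isv 0))) <| conj <| (List.range K).flatMap fun i =>
    [Form.box (aD.imp (.dia (aM i))),
     Form.box (aD.imp (.box (aU.imp (.box (aD.imp (.dia (aM i))))))),
     Form.box (aD.imp (.box ((aM i).imp ((Form.neg aD).and (Form.neg aU))))),
     conj (((List.range K).filter (· ≠ i)).map fun j =>
       Form.box (aD.imp (.box ((aM i).imp (Form.neg (aM j)))))),
     conj (((List.range K).filter (· ≠ i)).map fun j =>
       Form.boxr2 ((Form.dia (isv i)).imp
         (.rem2 (.dia ((isv i).and (.neg (.dia (aM j))))))))]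

theorem sat_goodForm {W : Type} (M : SLLModel W) (s : W) (K : ℕ) :
    Sat M (goodForm K) s [] ↔ Sat M (.rem2 (.dia (isv 0))) s [] ∧ ∀ i < K,
      (∀ d, (s, d) ∈ M.R1 → d ∈ M.V 0 → ∃ m, (d, m) ∈ M.R1 ∧ m ∈ M.V (2 * i + 2)) ∧
      (∀ d, (s, d) ∈ M.R1 → d ∈ M.V 0 → ∀ u, (d, u) ∈ M.R1 → u ∈ M.V 1 → ∀ d', (u, d') ∈ M.R1 →
        d' ∈ M.V 0 → ∃ m, (d', m) ∈ M.R1 ∧ m ∈ M.V (2 * i + 2)) ∧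
      (∀ d, (s, d) ∈ M.R1 → d ∈ M.V 0 → ∀ m, (d, m) ∈ M.R1 → m ∈ M.V (2 * i + 2) →
        m ∉ M.V 0 ∧ m ∉ M.V 1) ∧
      (∀ j < K, j ≠ i → ∀ d, (s, d) ∈ M.R1 → d ∈ M.V 0 → ∀ m, (d, m) ∈ M.R1 →
        m ∈ M.V (2 * i + 2) → m ∉ M.V (2 * j + 2)) ∧
      (∀ j < K, j ≠ i → Sat M (Form.boxr2 ((Form.dia (isv i)).imp
         (.rem2 (.dia ((isv i).and (.neg (.dia (aM j)))))))) s []) := by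
  have h1 : Sat M (goodForm K) s [] ↔ Sat M (.rem2 (.dia (isv 0))) s [] ∧
    Sat M (conj <| (List.range K).flatMap fun i =>
    [Form.box (aD.imp (.dia (aM i))),
     Form.box (aD.imp (.box (aU.imp (.box (aD.imp (.dia (aM i))))))),
     Form.box (aD.imp (.box ((aM i).imp ((Form.neg aD).and (Form.neg aU))))),
     conj (((List.range K).filter (· ≠ i)).map fun j =>
       Form.box (aD.imp (.box ((aM i).imp (Form.neg (aM j)))))),
     conj (((List.range K).filter (· ≠ i)).map fun j =>
       Form.boxr2 ((Form.dia (isv i)).imp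
         (.rem2 (.dia ((isv i).and (.neg (.dia (aM j))))))))]) s [] := Iff.rfl
  rw [h1]
  refine and_congr_right fun _ => ?_
  rw [sat_conj]
  simp only [List.mem_flatMap, List.mem_range, List.mem_cons, List.not_mem_nil, or_false]
  constructor
  · intro h i hi
    refine ⟨?_, ?_, ?_, ?_, ?_⟩
    · have := h _ ⟨i, hi, Or.inl rfl⟩
      simpa only [sat_box, sat_imp, aD, aU, aM, Sat] using this
    · have := h _ ⟨i, hi, Or.inr (Or.inl rfl)⟩
      simpa only [sat_box, sat_imp, aD, aU, aM, Sat] using this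
    · have := h _ ⟨i, hi, Or.inr (Or.inr (Or.inl rfl))⟩
      simpa only [sat_box, sat_imp, aD, aU, aM, Sat] using this
    · have := h _ ⟨i, hi, Or.inr (Or.inr (Or.inr (Or.inl rfl)))⟩
      rw [sat_conj] at this
      intro j hj hji
      have := this _ (List.mem_map.2 ⟨j, by simp [hj, hji], rfl⟩)
      simpa only [sat_box, sat_imp, aD, aU, aM, Sat] using this
    · have := h _ ⟨i, hi, Or.inr (Or.inr (Or.inr (Or.inr rfl)))⟩
      rw [sat_conj] at this
      intro j hj hji
      exact this _ (List.mem_map.2 ⟨j, by simp [hj, hji], rfl⟩)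
  · rintro h φ ⟨i, hi, hφ⟩
    obtain ⟨g1, g2, g3, g4, g5⟩ := h i hi
    rcases hφ with rfl | rfl | rfl | rfl | rfl
    · simpa only [sat_box, sat_imp, aD, aU, aM, Sat] using g1
    · simpa only [sat_box, sat_imp, aD, aU, aM, Sat] using g2
    · simpa only [sat_box, sat_imp, aD, aU, aM, Sat] using g3
    · rw [sat_conj]
      intro φ hφ
      obtain ⟨j, hj, rfl⟩ := List.mem_map.1 hφ
      simp only [List.mem_filter, List.mem_range, decide_eq_true_eq] at hj
      simpa only [sat_box, sat_imp, aD, aU, aM, Sat] using g4 j hj.1 hj.2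
    · rw [sat_conj]
      intro φ hφ
      obtain ⟨j, hj, rfl⟩ := List.mem_map.1 hφ
      simp only [List.mem_filter, List.mem_range, decide_eq_true_eq] at hj
      exact g5 j hj.1 hj.2

theorem nameable_of_del {W : Type} {M : SLLModel W} {s : W} {i : ℕ} {e : W × W}
    (ser : ∀ d, (s, d) ∈ M.R1 → d ∈ M.V 0 → ∃ m, (d, m) ∈ M.R1 ∧ m ∈ M.V (2 * i + 2))
    (he : e ∉ M.R2) (h : Sat (M.del e) (.dia (isv i)) s []) :
    ∃ d m, e = (d, m) ∧ (s, d) ∈ M.R1 ∧ d ∈ M.V 0 ∧ Nameable M i d m := by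
  obtain ⟨d, hd1, hd2, hd3⟩ := h
  have hdV : d ∈ M.V 0 := hd2
  have hd1 : (s, d) ∈ M.R1 := hd1.1
  have key : ∀ m, (d, m) ∈ M.R1 → m ∈ M.V (2 * i + 2) → (d, m) = e := by
    intro m hm hm'
    by_contra hne
    exact hd3 ⟨m, ⟨hm, hne⟩, hm'⟩
  obtain ⟨m, hm, hm'⟩ := ser d hd1 hdV
  refine ⟨d, m, (key m hm hm').symm, hd1, hdV, hm, ?_, hm', ?_⟩
  · rw [key m hm hm']; exact he
  · intro m' k1 k2
    have := (key m' k1 k2).trans (key m hm hm').symm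
    simpa using this

theorem good_of_sat {W : Type} {M : SLLModel W} {s : W} {K : ℕ} (hK : 0 < K)
    (h : Sat M (goodForm K) s []) :
    ∃ (X : Type) (f : X → W) (B : ℕ → X → X → Prop) (mk : ℕ → X → W),
      Nonempty X ∧ Good M s K f B mk := by
  rw [sat_goodForm] at h
  obtain ⟨h0, h⟩ := h
  have uni : ∀ i < K, ∀ j < K, ∀ d m, (s, d) ∈ M.R1 → d ∈ M.V 0 → Nameable M i d m →
      ∃ m', Nameable M j d m' := by
    intro i hi j hj d m hd hdV hN
    by_cases hji : j = i
    · subst hji; exact ⟨m, hN⟩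
    have g := (h i hi).2.2.2.2 j hj hji
    rw [sat_boxr2_nil] at g
    have hm := (h i hi).2.2.1 d hd hdV m hN.1 hN.2.2.1
    have hmj := (h i hi).2.2.2.1 j hj hji d hd hdV m hN.1 hN.2.2.1
    have g := g (d, m) hN.1 hN.2.1
    rw [sat_imp, sat_rem2_nil] at g
    have pre : Sat (M.del (d, m)) (.dia (isv i)) s [] := by
      refine ⟨d, ⟨hd, ?_⟩, hdV, ?_⟩
      · simp only [Set.mem_singleton_iff, Prod.mk.injEq]
        rintro ⟨-, rfl⟩; exact hm.1 hdV
      · rintro ⟨m', ⟨h1, h2⟩, h3⟩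
        exact h2 (by rw [hN.2.2.2 m' h1 h3]; rfl)
    obtain ⟨e', he1, he2, d', hd', ⟨hV', hi'⟩, hj'⟩ := g pre
    have hd'1 : (s, d') ∈ M.R1 := hd'.1.1
    have hV' : d' ∈ M.V 0 := hV'
    have ser' : ∀ d, (s, d) ∈ (M.del (d, m)).R1 → True := fun _ _ => trivial
    have key : ∀ m', (d', m') ∈ M.R1 → m' ∈ M.V (2 * j + 2) → (d', m') = e' := by
      intro m' k1 k2
      by_contra hne
      refine hj' ⟨m', ⟨⟨k1, ?_⟩, hne⟩, k2⟩
      simp only [Set.mem_singleton_iff, Prod.mk.injEq]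
      rintro ⟨-, rfl⟩; exact hmj k2
    obtain ⟨m', k1, k2⟩ := (h j hj).1 d' hd'1 hV'
    have he' := key m' k1 k2
    subst he'
    have hm'i := (h j hj).2.2.2.1 i hi (Ne.symm hji) d' hd'1 hV' m' k1 k2
    have hdd : d' = d := by
      obtain ⟨m₂, l1, l2⟩ := (h i hi).1 d' hd'1 hV'
      by_contra hne
      refine hi' ⟨m₂, ⟨⟨l1, ?_⟩, ?_⟩, l2⟩
      · simp only [Set.mem_singleton_iff, Prod.mk.injEq]
        rintro ⟨h, -⟩; exact hne h
      · simp only [Set.mem_singleton_iff, Prod.mk.injEq]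
        rintro ⟨-, rfl⟩; exact hm'i l2
    subst hdd
    refine ⟨m', k1, he2, k2, fun m₂ l1 l2 => ?_⟩
    simpa using key m₂ l1 l2
  let X := {d : W // (s, d) ∈ M.R1 ∧ d ∈ M.V 0 ∧ ∃ m, Nameable M 0 d m}
  have ex : ∀ (i : ℕ) (x : X), ∃ m, i < K → Nameable M i x.1 m := by
    rintro i ⟨d, h1, h2, m, h3⟩
    by_cases hi : i < K
    · obtain ⟨m', hm'⟩ := uni 0 hK i hi d m h1 h2 h3
      exact ⟨m', fun _ => hm'⟩
    · exact ⟨d, fun h => absurd h hi⟩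
  choose mk hmk using ex
  refine ⟨X, Subtype.val, fun l x y => ∃ u, (x.1, u) ∈ M.R1 ∧ u ∈ M.V 1 ∧ u ∈ M.V (2 * l + 3) ∧
    (u, y.1) ∈ M.R1, mk, ?_, ?_⟩
  · rw [sat_rem2_nil] at h0
    obtain ⟨e, -, h2, h3⟩ := h0
    obtain ⟨d, m, -, k1, k2, k3⟩ := nameable_of_del (h 0 hK).1 h2 h3
    exact ⟨⟨d, k1, k2, m, k3⟩⟩
  · exact
    { inj := Subtype.val_injective
      root := fun x => x.2.1
      dom := fun x => x.2.2.1
      nam := fun i hi x => hmk i x hi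
      disj := fun d m h1 h2 h3 i hi h4 =>
        ⟨((h i hi).2.2.1 d h1 h2 m h3 h4).1, ((h i hi).2.2.1 d h1 h2 m h3 h4).2,
          fun j hj hji => (h i hi).2.2.2.1 j hj hji d h1 h2 m h3 h4⟩
      compl := fun d m h1 h2 i hi hN => ⟨⟨d, h1, h2, uni i hi 0 hK d m h1 h2 hN⟩, rfl⟩
      ser1 := fun d h1 h2 i hi => (h i hi).1 d h1 h2
      ser2 := fun d u d' h1 h2 h3 h4 h5 h6 i hi => (h i hi).2.1 d h1 h2 u h3 h4 d' h5 h6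
      rel := fun l x y => Iff.rfl }

theorem Good.sat_goodForm {W X : Type} {M : SLLModel W} {s : W} {K : ℕ} {f : X → W}
    {B : ℕ → X → X → Prop} {mk : ℕ → X → W} (G : Good M s K f B mk) (hK : 0 < K) (x₀ : X) :
    Sat M (goodForm K) s [] := by
  rw [SLLAux.sat_goodForm]
  have nD : ∀ i < K, ∀ x, mk i x ∉ M.V 0 := fun i hi x =>
    (G.disj _ _ (G.root x) (G.dom x) (G.nam i hi x).1 i hi (G.nam i hi x).2.2.1).1
  refine ⟨?_, fun i hi => ⟨fun d h1 h2 => G.ser1 d h1 h2 i hi,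
    fun d h1 h2 u h3 h4 d' h5 h6 => G.ser2 d u d' h1 h2 h3 h4 h5 h6 i hi,
    fun d h1 h2 m h3 h4 => ⟨(G.disj d m h1 h2 h3 i hi h4).1, (G.disj d m h1 h2 h3 i hi h4).2.1⟩,
    fun j hj hji d h1 h2 m h3 h4 => (G.disj d m h1 h2 h3 i hi h4).2.2 j hj hji, ?_⟩⟩
  · rw [sat_rem2_nil]
    obtain ⟨k1, k2, k3, k4⟩ := G.nam 0 hK x₀
    refine ⟨_, k1, k2, f x₀, ⟨G.root _, ?_⟩, G.dom _, ?_⟩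
    · simp only [Set.mem_singleton_iff, Prod.mk.injEq]
      rintro ⟨-, h⟩; exact nD 0 hK x₀ (h ▸ G.dom x₀)
    · rintro ⟨m', ⟨h1, h2⟩, h3⟩
      exact h2 (by rw [k4 m' h1 h3]; rfl)
  · intro j hj hji
    rw [sat_boxr2_nil]
    intro e he he2
    rw [sat_imp, sat_rem2_nil]
    intro hs
    obtain ⟨d, m, rfl, k1, k2, k3⟩ := nameable_of_del (fun d h1 h2 => G.ser1 d h1 h2 i hi) he2 hs
    obtain ⟨x, rfl⟩ := G.compl d m k1 k2 i hi k3
    have hm : mk i x = m := k3.2.2.2 _ (G.nam i hi x).1 (G.nam i hi x).2.2.1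
    subst hm
    obtain ⟨l1, l2, l3, l4⟩ := G.nam j hj x
    have hne : mk j x ≠ mk i x := fun h =>
      (G.disj _ _ k1 k2 k3.1 i hi k3.2.2.1).2.2 j hj hji (h ▸ l3)
    refine ⟨(f x, mk j x), ⟨l1, by simpa using hne⟩, l2, f x, ⟨⟨k1, ?_⟩, ?_⟩, ⟨k2, ?_⟩, ?_⟩
    · simp only [Set.mem_singleton_iff, Prod.mk.injEq]
      rintro ⟨-, h⟩; exact nD i hi x (h ▸ k2)
    · simp only [Set.mem_singleton_iff, Prod.mk.injEq]
      rintro ⟨-, h⟩; exact nD j hj x (h ▸ k2)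
    · rintro ⟨m', ⟨⟨h1, h2⟩, -⟩, h3⟩
      exact h2 (by rw [k3.2.2.2 m' h1 h3]; rfl)
    · rintro ⟨m', ⟨⟨h1, -⟩, h2⟩, h3⟩
      exact h2 (by rw [l4 m' h1 h3]; rfl)

/-! ### The standard model of a family of binary relations -/

inductive SW (X : Type) : Type
  | root : SW X
  | dat : X → SW X
  | edg : ℕ → X → X → SW X
  | mrk : ℕ → SW X

def stdR {X : Type} (B : ℕ → X → X → Prop) : SW X → SW X → Prop
  | .root, .dat _ => True
  | .dat x, .edg l x' y => x' = x ∧ B l x y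
  | .dat _, .mrk _ => True
  | .edg _ _ y, .dat y' => y' = y
  | _, _ => False

def stdV {X : Type} (n : ℕ) : SW X → Prop
  | .root => False
  | .dat _ => n = 0
  | .edg l _ _ => n = 1 ∨ n = 2 * l + 3
  | .mrk i => n = 2 * i + 2

def std {X : Type} (B : ℕ → X → X → Prop) : SLLModel (SW X) where
  R1 := {e | stdR B e.1 e.2}
  R2 := ∅
  V n := {w | stdV n w}

theorem std_good {X : Type} (B : ℕ → X → X → Prop) (K : ℕ) :
    Good (std B) .root K SW.dat B (fun i _ => .mrk i) where
  inj := fun x y h => by simpa using h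
  root := fun x => trivial
  dom := fun x => rfl
  nam := fun i hi x => by
    refine ⟨trivial, fun h => h, rfl, ?_⟩
    rintro (_ | _ | _ | i') h1 h2
    · exact h1.elim
    · exact h1.elim
    · have h2 : 2 * i + 2 = 1 ∨ 2 * i + 2 = 2 * _ + 3 := h2
      omega
    · have h2 : 2 * i + 2 = 2 * i' + 2 := h2
      have : i' = i := by omega
      rw [this]
  disj := by
    rintro d (_ | _ | _ | i') h1 h2 h3 i hi h4
    · exact h4.elim
    · exact absurd h4 (by change ¬ (2 * i + 2 = 0); omega)
    · exact absurd h4 (by change ¬ (2 * i + 2 = 1 ∨ 2 * i + 2 = 2 * _ + 3); omega)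
    · have h4 : 2 * i + 2 = 2 * i' + 2 := h4
      refine ⟨?_, ?_, fun j hj hji => ?_⟩
      · change ¬ (0 = 2 * i' + 2); omega
      · change ¬ (1 = 2 * i' + 2); omega
      · change ¬ (2 * j + 2 = 2 * i' + 2); omega
  compl := by
    rintro (_ | x | _ | i') m h1 h2 i hi h3
    · exact h1.elim
    · exact ⟨x, rfl⟩
    · exact h1.elim
    · exact h1.elim
  ser1 := by
    rintro (_ | x | _ | i') h1 h2 i hi
    · exact h1.elim
    · exact ⟨.mrk i, trivial, rfl⟩
    · exact h1.elim
    · exact h1.elim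
  ser2 := by
    rintro d u (_ | x | _ | i') h1 h2 h3 h4 h5 h6 i hi
    · exact h6.elim
    · exact ⟨.mrk i, trivial, rfl⟩
    · exact absurd h6 (by change ¬ (0 = 1 ∨ 0 = 2 * _ + 3); omega)
    · exact absurd h6 (by change ¬ (0 = 2 * _ + 2); omega)
  rel := by
    intro l x y
    constructor
    · intro h
      exact ⟨.edg l x y, ⟨rfl, h⟩, Or.inl rfl, Or.inr rfl, rfl⟩
    · rintro ⟨u, h1, h2, h3, h4⟩
      rcases u with _ | _ | ⟨l', x', y'⟩ | i'
      · exact h1.elim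
      · exact h1.elim
      · obtain ⟨rfl, h1⟩ := h1
        have h4 : y = y' := h4
        have h3 : 2 * l + 3 = 1 ∨ 2 * l + 3 = 2 * l' + 3 := h3
        have : l' = l := by omega
        subst this h4
        exact h1
      · exact absurd h2 (by change ¬ (1 = 2 * _ + 2); omega)

/-- The SLL-formula of a first-order sentence. -/
def sent (K : ℕ) (q : Q) : Form := (goodForm K).and (trans q 0)

theorem sent_sound {W : Type} {M : SLLModel W} {s : W} {K : ℕ} (hK : 0 < K) {q : Q}
    (hq : okQ K q 0) (h : Sat M (sent K q) s []) :
    ∃ (X : Type) (f : X → W) (B : ℕ → X → X → Prop) (ρ : ℕ → X),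
      Function.Injective f ∧ real B q 0 ρ := by
  obtain ⟨X, f, B, mk, ⟨x⟩, G⟩ := good_of_sat hK h.1
  refine ⟨X, f, B, fun _ => x, G.inj, ?_⟩
  have := G.sat_trans q 0 (Nat.zero_le _) (fun _ => x) hq
  rw [minus_zero] at this
  exact this.1 h.2

theorem sent_complete {X : Type} (B : ℕ → X → X → Prop) (ρ : ℕ → X) {K : ℕ} (hK : 0 < K) {q : Q}
    (hq : okQ K q 0) (h : real B q 0 ρ) : Sat (std B) (sent K q) .root [] := by
  have G := std_good B K
  refine ⟨G.sat_goodForm hK (ρ 0), ?_⟩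
  have := G.sat_trans q 0 (Nat.zero_le _) ρ hq
  rw [minus_zero] at this
  exact this.2 h

/-! ### Derived first-order connectives -/

namespace Q
def all (q : Q) : Q := neg (ex (neg q))
def imp (p q : Q) : Q := neg (and p (neg q))
def allN : ℕ → Q → Q
  | 0, q => q
  | k + 1, q => all (allN k q)
def impL : List Q → Q → Q
  | [], q => q
  | p :: l, q => imp p (impL l q)
def rule (k : ℕ) (body : List Q) (hd : Q) : Q := allN k (impL body hd)
end Q

theorem real_all {X : Type} (B : ℕ → X → X → Prop) (q : Q) (n : ℕ) (ρ : ℕ → X) :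
    real B (Q.all q) n ρ ↔ ∀ a, real B q (n + 1) (Function.update ρ n a) := by
  simp [Q.all, real]

theorem real_imp {X : Type} (B : ℕ → X → X → Prop) (p q : Q) (n : ℕ) (ρ : ℕ → X) :
    real B (Q.imp p q) n ρ ↔ (real B p n ρ → real B q n ρ) := by
  simp [Q.imp, real]

/-! ### The infinity axiom -/

def infQ : Q :=
  .and (Q.all (.ex (.B 0 0 1)))
    (.and (Q.rule 1 [.B 0 0 0] (.neg (.B 0 0 0)))
      (Q.rule 3 [.B 0 0 1, .B 0 1 2] (.B 0 0 2)))

theorem infQ_ok : okQ 8 infQ 0 := by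
  simp [infQ, Q.rule, Q.allN, Q.impL, Q.imp, Q.all, okQ]

theorem infQ_real {X : Type} (B : ℕ → X → X → Prop) (ρ : ℕ → X) :
    real B infQ 0 ρ ↔ (∀ x, ∃ y, B 0 x y) ∧ (∀ x, B 0 x x → ¬ B 0 x x) ∧
      (∀ x y z, B 0 x y → B 0 y z → B 0 x z) := by
  simp [infQ, Q.rule, Q.allN, Q.impL, real_imp, real_all, real, Function.update]

theorem no_fmp : ∃ φ : Form,
      (∃ (W : Type) (M : SLLModel W) (w : W), Sat M φ w []) ∧
      (∀ (W : Type) (M : SLLModel W) (w : W), Sat M φ w [] → Infinite W) := by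
  refine ⟨sent 8 infQ, ⟨SW ℕ, std (fun _ x y => x < y), .root,
    sent_complete _ (fun _ => 0) (by norm_num) infQ_ok ?_⟩, ?_⟩
  · rw [infQ_real]
    refine ⟨fun x => ⟨x + 1, by simp⟩, fun x h => by simp, fun x y z h1 h2 => lt_trans h1 h2⟩
  · intro W M w h
    obtain ⟨X, f, B, ρ, hf, hr⟩ := sent_sound (by norm_num) infQ_ok h
    rw [infQ_real] at hr
    obtain ⟨h1, h2, h3⟩ := hr
    choose g hg using h1
    have hlt : ∀ m n, m < n → B 0 (g^[m] (ρ 0)) (g^[n] (ρ 0)) := by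
      intro m n hmn
      induction n, hmn using Nat.le_induction with
      | base => rw [Function.iterate_succ_apply']; exact hg _
      | succ n _ ih => rw [Function.iterate_succ_apply']; exact h3 _ _ _ ih (hg _)
    have hinj : Function.Injective (fun n => g^[n] (ρ 0)) := by
      intro m n hmn
      by_contra hne
      simp only at hmn
      rcases Nat.lt_or_gt_of_ne hne with hlt' | hlt'
      · have := hlt _ _ hlt'
        rw [hmn] at this
        exact h2 _ this this
      · have := hlt _ _ hlt'
        rw [hmn] at this
        exact h2 _ this this
    exact Infinite.of_injective _ (hf.comp hinj)

/-! ### Encoding computations -/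

open Turing.ToPartrec (Code)

def cnum : Code → ℕ
  | .zero' => Nat.pair 0 0
  | .succ => Nat.pair 1 0
  | .tail => Nat.pair 2 0
  | .cons f g => Nat.pair 3 (Nat.pair (cnum f) (cnum g))
  | .comp f g => Nat.pair 4 (Nat.pair (cnum f) (cnum g))
  | .case f g => Nat.pair 5 (Nat.pair (cnum f) (cnum g))
  | .fix f => Nat.pair 6 (cnum f)

theorem cnum_inj : Function.Injective cnum := by
  intro c
  induction c with
  | zero' => intro d h; cases d <;> simp [cnum, Nat.pair_eq_pair] at h ⊢
  | succ => intro d h; cases d <;> simp [cnum, Nat.pair_eq_pair] at h ⊢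
  | tail => intro d h; cases d <;> simp [cnum, Nat.pair_eq_pair] at h ⊢
  | cons f g ih1 ih2 =>
    intro d h; cases d <;> simp [cnum, Nat.pair_eq_pair] at h ⊢; exact ⟨ih1 h.1, ih2 h.2⟩
  | comp f g ih1 ih2 =>
    intro d h; cases d <;> simp [cnum, Nat.pair_eq_pair] at h ⊢; exact ⟨ih1 h.1, ih2 h.2⟩
  | case f g ih1 ih2 =>
    intro d h; cases d <;> simp [cnum, Nat.pair_eq_pair] at h ⊢; exact ⟨ih1 h.1, ih2 h.2⟩
  | fix f ih => intro d h; cases d <;> simp [cnum, Nat.pair_eq_pair] at h ⊢; exact ih h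

inductive Lab : Type
  | nil | zero | suc | hd | tl | hI | tL
  | inp : ℕ → Lab
  | graph : Code → Lab

def lab : Lab → ℕ
  | .inp n => 2 * n
  | .nil => 2 * Nat.pair 0 0 + 1
  | .zero => 2 * Nat.pair 0 1 + 1
  | .suc => 2 * Nat.pair 0 2 + 1
  | .hd => 2 * Nat.pair 0 3 + 1
  | .tl => 2 * Nat.pair 0 4 + 1
  | .hI => 2 * Nat.pair 0 5 + 1
  | .tL => 2 * Nat.pair 0 6 + 1
  | .graph c => 2 * Nat.pair 1 (cnum c) + 1

theorem lab_inj : Function.Injective lab := by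
  have e : ∀ a b : ℕ, 2 * a ≠ 2 * b + 1 := by omega
  have e' : ∀ a b : ℕ, 2 * b + 1 ≠ 2 * a := by omega
  intro a b h
  cases a <;> cases b <;> simp only [lab, e, e', add_left_inj, Nat.mul_right_inj (two_ne_zero),
    Nat.pair_eq_pair] at h <;> simp at h ⊢
  · exact h
  · exact cnum_inj h

/-- Standard interpretation on lists. -/
def interp : Lab → List ℕ → List ℕ → Prop
  | .nil, x, y => x = y ∧ x = []
  | .zero, x, y => x = y ∧ x.headI = 0
  | .suc, x, y => y.headI = x.headI + 1
  | .hd, c, x => c ≠ [] ∧ c.headI = x.headI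
  | .tl, c, t => c ≠ [] ∧ c.tail = t
  | .hI, x, n => x.headI = n.headI
  | .tL, x, t => x.tail = t
  | .inp n, x, y => x = y ∧ x.headI = n
  | .graph c, x, y => y ∈ c.eval x

def stdB (l : ℕ) (x y : List ℕ) : Prop := ∃ L, lab L = l ∧ interp L x y

theorem stdB_lab (L : Lab) (x y : List ℕ) : stdB (lab L) x y ↔ interp L x y := by
  constructor
  · rintro ⟨L', h, h'⟩
    rwa [← lab_inj h]
  · intro h; exact ⟨L, rfl, h⟩

def atm (L : Lab) (i j : ℕ) : Q := .B (lab L) i j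

def baseQ : Q :=
  .and (.ex (.and (atm .nil 0 0) (.and (atm .zero 0 0) (.and (atm .hI 0 0) (atm .tL 0 0)))))
  (.and (Q.rule 2 [atm .hd 0 1] (atm .hI 0 1))
  (.and (Q.rule 2 [atm .tl 0 1] (atm .tL 0 1))
  (.and (Q.all (.ex (atm .suc 0 1)))
    (Q.all (Q.all (.ex (.and (atm .hd 2 0) (atm .tl 2 1))))))))

/-- Horn rules for the graphs of (the subcodes of) a code. -/
def codeQ : Code → Q
  | .zero' => Q.rule 3 [atm .hd 1 2, atm .zero 2 2, atm .tl 1 0] (atm (.graph .zero') 0 1)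
  | .succ => Q.rule 5 [atm .hI 0 2, atm .suc 2 3, atm .hd 1 3, atm .tl 1 4, atm .nil 4 4]
      (atm (.graph .succ) 0 1)
  | .tail => Q.rule 2 [atm .tL 0 1] (atm (.graph .tail) 0 1)
  | .cons f g => .and (Q.rule 5 [atm (.graph f) 0 2, atm .hI 2 3, atm .hd 1 3,
        atm (.graph g) 0 4, atm .tl 1 4] (atm (.graph (.cons f g)) 0 1))
      (.and (codeQ f) (codeQ g))
  | .comp f g => .and (Q.rule 3 [atm (.graph g) 0 2, atm (.graph f) 2 1]
        (atm (.graph (.comp f g)) 0 1))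
      (.and (codeQ f) (codeQ g))
  | .case f g => .and (.and
      (Q.rule 4 [atm .hI 0 2, atm .zero 2 2, atm .tL 0 3, atm (.graph f) 3 1]
        (atm (.graph (.case f g)) 0 1))
      (Q.rule 6 [atm .hI 0 2, atm .suc 3 2, atm .tL 0 4, atm .hd 5 3, atm .tl 5 4,
        atm (.graph g) 5 1] (atm (.graph (.case f g)) 0 1)))
      (.and (codeQ f) (codeQ g))
  | .fix f => .and (.and
      (Q.rule 4 [atm (.graph f) 0 2, atm .hI 2 3, atm .zero 3 3, atm .tL 2 1]
        (atm (.graph (.fix f)) 0 1))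
      (Q.rule 6 [atm (.graph f) 0 2, atm .hI 2 3, atm .suc 4 3, atm .tL 2 5,
        atm (.graph (.fix f)) 5 1] (atm (.graph (.fix f)) 0 1)))
      (codeQ f)

def inpQ : ℕ → Q
  | 0 => Q.rule 1 [atm .zero 0 0] (atm (.inp 0) 0 0)
  | n + 1 => .and (Q.rule 2 [atm (.inp n) 0 0, atm .suc 0 1] (atm (.inp (n + 1)) 1 1)) (inpQ n)

def goalQ (c : Code) (n : ℕ) : Q :=
  Q.rule 4 [atm (.inp n) 0 0, atm .hd 1 0, atm .tl 1 2, atm .nil 2 2] (.neg (atm (.graph c) 1 3))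

def haltQ (c : Code) (n : ℕ) : Q := .and (.and baseQ (codeQ c)) (.and (inpQ n) (goalQ c n))

theorem baseQ_ok : okQ 8 baseQ 0 := by
  simp [baseQ, atm, Q.rule, Q.allN, Q.impL, Q.imp, Q.all, okQ]

theorem codeQ_ok (c : Code) : okQ 8 (codeQ c) 0 := by
  induction c <;> simp_all [codeQ, atm, Q.rule, Q.allN, Q.impL, Q.imp, Q.all, okQ]

theorem inpQ_ok (n : ℕ) : okQ 8 (inpQ n) 0 := by
  induction n <;> simp_all [inpQ, atm, Q.rule, Q.allN, Q.impL, Q.imp, Q.all, okQ]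

theorem haltQ_ok (c : Code) (n : ℕ) : okQ 8 (haltQ c n) 0 := by
  refine ⟨⟨baseQ_ok, codeQ_ok c⟩, inpQ_ok n, ?_⟩
  simp [goalQ, atm, Q.rule, Q.allN, Q.impL, Q.imp, Q.all, okQ]

theorem baseQ_real {X : Type} (B : ℕ → X → X → Prop) (ρ : ℕ → X) :
    real B baseQ 0 ρ ↔
      (∃ e, B (lab .nil) e e ∧ B (lab .zero) e e ∧ B (lab .hI) e e ∧ B (lab .tL) e e) ∧
      (∀ x y, B (lab .hd) x y → B (lab .hI) x y) ∧
      (∀ x y, B (lab .tl) x y → B (lab .tL) x y) ∧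
      (∀ x, ∃ y, B (lab .suc) x y) ∧
      (∀ x y, ∃ c, B (lab .hd) c x ∧ B (lab .tl) c y) := by
  simp [baseQ, atm, Q.rule, Q.allN, Q.impL, real_imp, real_all, real, Function.update]

theorem std_base (ρ : ℕ → List ℕ) : real stdB baseQ 0 ρ := by
  rw [baseQ_real]
  simp only [stdB_lab, interp]
  refine ⟨⟨[], by simp⟩, fun x y h => h.2, fun x y h => h.2, fun x => ⟨[x.headI + 1], rfl⟩,
    fun x y => ⟨x.headI :: y, by simp⟩⟩

theorem case_eval0 (f g : Code) (v : List ℕ) (h : v.headI = 0) :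
    (Code.case f g).eval v = f.eval v.tail := by
  simp only [Turing.ToPartrec.Code.case_eval, h]
  rfl

theorem case_evalS (f g : Code) (v : List ℕ) (n : ℕ) (h : v.headI = n + 1) :
    (Code.case f g).eval v = g.eval (n :: v.tail) := by
  simp only [Turing.ToPartrec.Code.case_eval, h]

theorem mem_fix_eval (f : Code) (v w : List ℕ) : w ∈ (Code.fix f).eval v ↔
    ∃ u ∈ f.eval v, (u.headI = 0 ∧ u.tail = w) ∨
      (u.headI ≠ 0 ∧ w ∈ (Code.fix f).eval u.tail) := by
  rw [Turing.ToPartrec.Code.fix_eval]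
  refine PFun.mem_fix_iff.trans ?_
  simp only [Part.mem_map_iff]
  constructor
  · rintro (⟨u, hu, h⟩ | ⟨a, ⟨u, hu, h⟩, h'⟩)
    · refine ⟨u, hu, ?_⟩
      split_ifs at h with h0
      · exact Or.inl ⟨h0, by simpa using h⟩
    · refine ⟨u, hu, ?_⟩
      split_ifs at h with h0
      · refine Or.inr ⟨h0, ?_⟩
        have : u.tail = a := by simpa using h
        rwa [this]
  · rintro ⟨u, hu, ⟨h0, h⟩ | ⟨h0, h⟩⟩
    · exact Or.inl ⟨u, hu, by simp [h0, h]⟩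
    · exact Or.inr ⟨u.tail, ⟨u, hu, by simp [h0]⟩, h⟩

theorem mem_cons_eval (f g : Code) (v w : List ℕ) : w ∈ (Code.cons f g).eval v ↔
    ∃ a ∈ f.eval v, ∃ b ∈ g.eval v, w = a.headI :: b := by
  simp [Turing.ToPartrec.Code.cons_eval, Part.bind_eq_bind, Part.pure_eq_some]

theorem mem_comp_eval (f g : Code) (v w : List ℕ) : w ∈ (Code.comp f g).eval v ↔
    ∃ a ∈ g.eval v, w ∈ f.eval a := by
  rw [Turing.ToPartrec.Code.comp_eval]
  exact Part.mem_bind_iff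

theorem cons_of {c x : List ℕ} (h : c ≠ []) {n : ℕ} (h1 : c.headI = n) (h2 : c.tail = x) :
    c = n :: x := by
  cases c with
  | nil => exact absurd rfl h
  | cons a l => simp at h1 h2; rw [h1, h2]

theorem std_code (c : Code) (ρ : ℕ → List ℕ) : real stdB (codeQ c) 0 ρ := by
  induction c with
  | zero' =>
    simp [codeQ, atm, Q.rule, Q.allN, Q.impL, real_imp, real_all, real, Function.update,
      stdB_lab, -ne_eq, interp, Part.pure_eq_some]
    intro x y z h1 h2 h3 _ h4
    exact cons_of h1 (h2.trans h3) h4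
  | succ =>
    simp [codeQ, atm, Q.rule, Q.allN, Q.impL, real_imp, real_all, real, Function.update,
      stdB_lab, -ne_eq, interp, Part.pure_eq_some]
    rintro x y n m e h1 h2 h3 h4 _ h5 rfl
    exact cons_of h3 (by rw [h4, h2, h1]) h5
  | tail =>
    simp [codeQ, atm, Q.rule, Q.allN, Q.impL, real_imp, real_all, real, Function.update,
      stdB_lab, -ne_eq, interp, Part.pure_eq_some]
  | cons f g ih1 ih2 =>
    refine ⟨?_, ih1, ih2⟩
    simp [atm, Q.rule, Q.allN, Q.impL, real_imp, real_all, real, Function.update,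
      stdB_lab, -ne_eq, interp, -Turing.ToPartrec.Code.cons_eval, mem_cons_eval]
    intro x y u n w h1 h2 h3 h4 h5 _ h6
    exact ⟨u, h1, w, h5, cons_of h3 (by rw [h4, h2]) h6⟩
  | comp f g ih1 ih2 =>
    refine ⟨?_, ih1, ih2⟩
    simp [atm, Q.rule, Q.allN, Q.impL, real_imp, real_all, real, Function.update,
      stdB_lab, -ne_eq, interp, -Turing.ToPartrec.Code.comp_eval, mem_comp_eval]
    intro x y u h1 h2
    exact ⟨u, h1, h2⟩
  | case f g ih1 ih2 =>
    refine ⟨⟨?_, ?_⟩, ih1, ih2⟩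
    · simp [atm, Q.rule, Q.allN, Q.impL, real_imp, real_all, real, Function.update,
        stdB_lab, -ne_eq, interp, -Turing.ToPartrec.Code.case_eval]
      intro x y z h1 h2 h3
      rw [case_eval0 f g x (h1.trans h2)]
      exact h3
    · simp [atm, Q.rule, Q.allN, Q.impL, real_imp, real_all, real, Function.update,
        stdB_lab, -ne_eq, interp, -Turing.ToPartrec.Code.case_eval]
      rintro x y m n t u h1 h2 rfl h3 h4 _ h5 h6
      rw [case_evalS f g x n.headI (h1.trans h2), ← cons_of h3 h4 h5]
      exact h6
  | fix f ih =>
    refine ⟨⟨?_, ?_⟩, ih⟩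
    · simp [atm, Q.rule, Q.allN, Q.impL, real_imp, real_all, real, Function.update,
        stdB_lab, -ne_eq, interp, -Turing.ToPartrec.Code.fix_eval]
      intro x y u z h1 h2 h3 h4
      rw [mem_fix_eval]
      exact ⟨u, h1, Or.inl ⟨h2.trans h3, h4⟩⟩
    · simp [atm, Q.rule, Q.allN, Q.impL, real_imp, real_all, real, Function.update,
        stdB_lab, -ne_eq, interp, -Turing.ToPartrec.Code.fix_eval]
      rintro x y u m n t h1 h2 h3 rfl h4
      rw [mem_fix_eval]
      exact ⟨u, h1, Or.inr ⟨by omega, h4⟩⟩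

theorem std_inp (n : ℕ) (ρ : ℕ → List ℕ) : real stdB (inpQ n) 0 ρ := by
  induction n with
  | zero =>
    simp [inpQ, atm, Q.rule, Q.allN, Q.impL, real_imp, real_all, real, Function.update,
      stdB_lab, interp]
  | succ n ih =>
    refine ⟨?_, ih⟩
    simp [atm, Q.rule, Q.allN, Q.impL, real_imp, real_all, real, Function.update,
      stdB_lab, interp]
    intro x y h1 h2
    omega

theorem goalQ_real {X : Type} (B : ℕ → X → X → Prop) (ρ : ℕ → X) (c : Code) (n : ℕ) :
    real B (goalQ c n) 0 ρ ↔ ∀ m x e y, B (lab (.inp n)) m m → B (lab .hd) x m →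
      B (lab .tl) x e → B (lab .nil) e e → ¬ B (lab (.graph c)) x y := by
  simp [goalQ, atm, Q.rule, Q.allN, Q.impL, real_imp, real_all, real, Function.update]

theorem std_halt (c : Code) (n : ℕ) (h : ¬ (c.eval [n]).Dom) :
    real stdB (haltQ c n) 0 (fun _ => []) := by
  refine ⟨⟨std_base _, std_code c _⟩, std_inp n _, ?_⟩
  rw [goalQ_real]
  simp only [stdB_lab, interp]
  rintro m x e y ⟨-, h1⟩ ⟨h2, h3⟩ ⟨-, h4⟩ ⟨-, rfl⟩ h5
  rw [cons_of h2 (h3.trans h1) h4] at h5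
  exact h (Part.dom_iff_mem.2 ⟨y, h5⟩)

theorem sound_halt {X : Type} (B : ℕ → X → X → Prop) (ρ : ℕ → X) (c : Code) (n : ℕ)
    (hr : real B (haltQ c n) 0 ρ) : ¬ (c.eval [n]).Dom := by
  obtain ⟨⟨hb, hc⟩, hi, hg⟩ := hr
  rw [baseQ_real] at hb
  rw [goalQ_real] at hg
  obtain ⟨⟨e, e1, e2, e3, e4⟩, b1, b2, b3, b4⟩ := hb
  choose sc hsc using b3
  choose cs hcs1 hcs2 using b4
  let num : ℕ → X := fun n => n.rec e (fun _ x => sc x)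
  have num0 : num 0 = e := rfl
  have numS : ∀ n, B (lab .suc) (num n) (num (n + 1)) := fun n => hsc _
  let h : List ℕ → X := fun l => l.rec e (fun n _ x => cs (num n) x)
  have hnil : h [] = e := rfl
  have hhd : ∀ n l, B (lab .hd) (h (n :: l)) (num n) := fun n l => hcs1 _ _
  have htl : ∀ n l, B (lab .tl) (h (n :: l)) (h l) := fun n l => hcs2 _ _
  have hHI : ∀ l, B (lab .hI) (h l) (num l.headI) := by
    rintro (_ | ⟨a, l⟩)
    · exact e3
    · exact b1 _ _ (hhd a l)
  have hTL : ∀ l, B (lab .tL) (h l) (h l.tail) := by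
    rintro (_ | ⟨a, l⟩)
    · exact e4
    · exact b2 _ _ (htl a l)
  clear_value num h
  have main : ∀ c : Code, real B (codeQ c) 0 ρ → ∀ v w, w ∈ c.eval v →
      B (lab (.graph c)) (h v) (h w) := by
    intro c
    induction c with
    | zero' =>
      intro hc v w hw
      simp [codeQ, atm, Q.rule, Q.allN, Q.impL, real_imp, real_all, real, Function.update,
        -ne_eq] at hc
      simp [Part.pure_eq_some] at hw
      subst hw
      exact hc _ _ _ (hhd 0 v) (by rw [num0]; exact e2) (htl _ _)
    | succ =>
      intro hc v w hw
      simp [codeQ, atm, Q.rule, Q.allN, Q.impL, real_imp, real_all, real, Function.update,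
        -ne_eq] at hc
      simp [Part.pure_eq_some] at hw
      subst hw
      exact hc _ _ _ _ _ (hHI v) (numS _) (hhd _ _) (htl _ _) (by rw [hnil]; exact e1)
    | tail =>
      intro hc v w hw
      simp [codeQ, atm, Q.rule, Q.allN, Q.impL, real_imp, real_all, real, Function.update,
        -ne_eq] at hc
      simp [Part.pure_eq_some] at hw
      subst hw
      exact hc _ _ (hTL v)
    | cons f g ih1 ih2 =>
      rintro ⟨hc, hf, hg⟩ v w hw
      simp [atm, Q.rule, Q.allN, Q.impL, real_imp, real_all, real, Function.update,
        -ne_eq] at hc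
      rw [mem_cons_eval] at hw
      obtain ⟨a, ha, b, hb, rfl⟩ := hw
      exact hc _ _ _ _ _ (ih1 hf v a ha) (hHI a) (hhd _ _) (ih2 hg v b hb) (htl _ _)
    | comp f g ih1 ih2 =>
      rintro ⟨hc, hf, hg⟩ v w hw
      simp [atm, Q.rule, Q.allN, Q.impL, real_imp, real_all, real, Function.update,
        -ne_eq] at hc
      rw [mem_comp_eval] at hw
      obtain ⟨a, ha, hb⟩ := hw
      exact hc _ _ _ (ih2 hg v a ha) (ih1 hf a w hb)
    | case f g ih1 ih2 =>
      rintro ⟨⟨hc1, hc2⟩, hf, hg⟩ v w hw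
      simp [atm, Q.rule, Q.allN, Q.impL, real_imp, real_all, real, Function.update,
        -ne_eq] at hc1 hc2
      rcases hn : v.headI with _ | k
      · rw [case_eval0 f g v hn] at hw
        have := hHI v
        rw [hn] at this
        exact hc1 _ _ _ _ this (by rw [num0]; exact e2) (hTL v) (ih1 hf _ _ hw)
      · rw [case_evalS f g v k hn] at hw
        have := hHI v
        rw [hn] at this
        exact hc2 _ _ _ _ _ _ this (numS k) (hTL v) (hhd _ _) (htl _ _) (ih2 hg _ _ hw)
    | fix f ih =>
      rintro ⟨⟨hc1, hc2⟩, hf⟩ v w hw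
      simp [atm, Q.rule, Q.allN, Q.impL, real_imp, real_all, real, Function.update,
        -ne_eq] at hc1 hc2
      rw [Turing.ToPartrec.Code.fix_eval] at hw
      refine PFun.fixInduction' (C := fun v => B (lab (.graph (.fix f))) (h v) (h w)) hw ?_ ?_
      · intro v hv
        obtain ⟨u, hu, hv⟩ := (Part.mem_map_iff _).1 hv
        split_ifs at hv with h0
        have hv : u.tail = w := by simpa using hv
        subst hv
        have := hHI u
        rw [h0] at this
        exact hc1 _ _ _ _ (ih hf v u hu) this (by rw [num0]; exact e2) (hTL u)
      · intro v v' _ hv hB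
        obtain ⟨u, hu, hv⟩ := (Part.mem_map_iff _).1 hv
        split_ifs at hv with h0
        have hv : u.tail = v' := by simpa using hv
        subst hv
        obtain ⟨k, hk⟩ := Nat.exists_eq_succ_of_ne_zero h0
        have := hHI u
        rw [hk] at this
        exact hc2 _ _ _ _ _ _ (ih hf v u hu) this (numS k) (hTL u) hB
  have hinp : ∀ n, real B (inpQ n) 0 ρ → B (lab (.inp n)) (num n) (num n) := by
    intro n
    induction n with
    | zero =>
      intro hi
      simp [inpQ, atm, Q.rule, Q.allN, Q.impL, real_imp, real_all, real, Function.update] at hi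
      exact hi _ (by rw [num0]; exact e2)
    | succ n ih =>
      rintro ⟨hi, hi'⟩
      simp [atm, Q.rule, Q.allN, Q.impL, real_imp, real_all, real, Function.update] at hi
      exact hi _ _ (ih hi') (numS n)
  intro hd
  obtain ⟨y, hy⟩ := Part.dom_iff_mem.1 hd
  exact hg _ _ _ _ (hinp n hi) (hhd n []) (htl n []) (by rw [hnil]; exact e1) (main c hc _ _ hy)

theorem sat_iff (c : Code) (n : ℕ) :
    (∃ (W : Type) (M : SLLModel W) (w : W), Sat M (sent 8 (haltQ c n)) w []) ↔
      ¬ (c.eval [n]).Dom := by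
  constructor
  · rintro ⟨W, M, w, h⟩
    obtain ⟨X, f, B, ρ, -, hr⟩ := sent_sound (by norm_num) (haltQ_ok c n) h
    exact sound_halt B ρ c n hr
  · intro h
    exact ⟨_, _, _, sent_complete stdB _ (by norm_num) (haltQ_ok c n) (std_halt c n h)⟩

/-! ### Computability of the reduction -/

def PF (F : ℕ → Form) : Prop := Primrec fun n => (F n).encode

theorem PF.const (φ : Form) : PF fun _ => φ := Primrec.const _

theorem pf_pair (k : ℕ) {g : ℕ → ℕ} (hg : Primrec g) : Primrec fun n => Nat.pair k (g n) :=
  Primrec₂.natPair.comp (Primrec.const k) hg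

theorem PF.atom {g : ℕ → ℕ} (hg : Primrec g) : PF fun n => .atom (g n) := pf_pair 0 hg
theorem PF.neg {F : ℕ → Form} (h : PF F) : PF fun n => .neg (F n) := pf_pair 1 h
theorem PF.and {F G : ℕ → Form} (h : PF F) (h' : PF G) : PF fun n => .and (F n) (G n) :=
  pf_pair 2 (Primrec₂.natPair.comp h h')
theorem PF.dia {F : ℕ → Form} (h : PF F) : PF fun n => .dia (F n) := pf_pair 3 h
theorem PF.rem2 {F : ℕ → Form} (h : PF F) : PF fun n => .rem2 (F n) := pf_pair 5 h

/-- Families of first-order formulas with primitive recursive translation. -/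
def PQ (F : ℕ → Q) : Prop := ∀ k, PF fun n => trans (F n) k

theorem PQ.const (q : Q) : PQ fun _ => q := fun _ => PF.const _
theorem PQ.neg {F : ℕ → Q} (h : PQ F) : PQ fun n => .neg (F n) := fun k => (h k).neg
theorem PQ.and {F G : ℕ → Q} (h : PQ F) (h' : PQ G) : PQ fun n => .and (F n) (G n) :=
  fun k => (h k).and (h' k)
theorem PQ.ex {F : ℕ → Q} (h : PQ F) : PQ fun n => .ex (F n) :=
  fun k => ((PF.const _).and (h (k + 1))).rem2
theorem PQ.all {F : ℕ → Q} (h : PQ F) : PQ fun n => Q.all (F n) := h.neg.ex.neg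
theorem PQ.imp {F G : ℕ → Q} (h : PQ F) (h' : PQ G) : PQ fun n => Q.imp (F n) (G n) :=
  (h.and h'.neg).neg
theorem PQ.B {g : ℕ → ℕ} (hg : Primrec g) (i j : ℕ) : PQ fun n => .B (g n) i j := fun _ =>
  ((PF.const _).and ((PF.const _).and
    ((PF.atom (Primrec.nat_add.comp (Primrec.nat_mul.comp (Primrec.const 2) hg)
      (Primrec.const 3))).and (PF.const _))).dia).dia
theorem PQ.inp {g : ℕ → ℕ} (hg : Primrec g) (i j : ℕ) : PQ fun n => atm (.inp (g n)) i j :=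
  PQ.B (Primrec.nat_mul.comp (Primrec.const 2) hg) i j

theorem PQ.inpQ : PQ inpQ := by
  intro k
  have hs : PQ fun n => Q.rule 2 [atm (.inp n) 0 0, atm .suc 0 1] (atm (.inp (n + 1)) 1 1) :=
    ((PQ.inp Primrec.id 0 0).imp ((PQ.const _).imp (PQ.inp Primrec.succ 1 1))).all.all
  have := Primrec.nat_rec₁ (trans (SLLAux.inpQ 0) k).encode
    (f := fun n r => Nat.pair 2 (Nat.pair (trans (Q.rule 2 [atm (.inp n) 0 0, atm .suc 0 1]
      (atm (.inp (n + 1)) 1 1)) k).encode r))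
    (Primrec₂.natPair.comp (Primrec.const 2)
      (Primrec₂.natPair.comp ((hs k).comp Primrec.fst) Primrec.snd))
  refine this.of_eq fun n => ?_
  induction n with
  | zero => rfl
  | succ n ih => simp only [ih]; rfl

theorem PQ.goal (c : Code) : PQ (goalQ c) :=
  ((PQ.inp Primrec.id 0 0).imp (PQ.const _)).all.all.all.all

theorem haltQ_primrec (c : Code) : PF fun n => sent 8 (haltQ c n) :=
  (PF.const _).and (((PQ.const (.and baseQ (codeQ c))).and (PQ.inpQ.and (PQ.goal c))) 0)

theorem exists_undec : ∃ c : Code, ¬ ComputablePred fun n : ℕ => ¬ (c.eval [n]).Dom := by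
  have hp : Partrec fun n : ℕ => (Denumerable.ofNat Nat.Partrec.Code n).eval 0 :=
    Nat.Partrec.Code.eval_part.comp (Computable.ofNat _) (Computable.const 0)
  obtain ⟨c, hc⟩ := Turing.ToPartrec.Code.exists_code (Nat.Partrec'.part_iff₁.2 hp)
  refine ⟨c, fun h => ?_⟩
  have hdom : ∀ n, (c.eval [n]).Dom ↔ ((Denumerable.ofNat Nat.Partrec.Code n).eval 0).Dom := by
    intro n
    have := hc ⟨[n], rfl⟩
    simp only at this
    rw [this]
    rfl
  apply ComputablePred.halting_problem 0
  refine ComputablePred.computable_of_manyOneReducible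
    (q := fun n : ℕ => (c.eval [n]).Dom) ⟨Encodable.encode, Computable.encode, fun a => ?_⟩ ?_
  · refine Iff.trans ?_ (hdom _).symm
    rw [Denumerable.ofNat_encode]
  · exact h.not.of_eq fun n => not_not

theorem undec : ¬ ComputablePred (fun n : ℕ => ∃ φ : Form, Form.encode φ = n ∧
      ∃ (W : Type) (M : SLLModel W) (w : W), Sat M φ w []) := by
  intro h
  obtain ⟨c, hc⟩ := exists_undec
  apply hc
  refine ComputablePred.computable_of_manyOneReducible ⟨_, (haltQ_primrec c).to_comp, fun n => ?_⟩ h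
  refine (sat_iff c n).symm.trans ?_
  constructor
  · intro h; exact ⟨_, rfl, h⟩
  · rintro ⟨φ, h1, h2⟩
    rwa [Form.encode_injective h1] at h2

end SLLAux

/-- SLL lacks the finite model property and its satisfiability problem is
undecidable: (i) some L-formula is satisfiable w.r.t. 𝔐• but only in infinite
models, and (ii) the set of (codes of) L-formulas satisfiable w.r.t. 𝔐• is not
a computable predicate. -/
theorem SLL_no_fmp_and_sat_undecidable :
    (∃ φ : Form,
      (∃ (W : Type) (M : SLLModel W) (w : W), Sat M φ w []) ∧
      (∀ (W : Type) (M : SLLModel W) (w : W), Sat M φ w [] → Infinite W)) ∧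
    ¬ ComputablePred (fun n : ℕ => ∃ φ : Form, Form.encode φ = n ∧
      ∃ (W : Type) (M : SLLModel W) (w : W), Sat M φ w []) := by
  exact ⟨SLLAux.no_fmp, SLLAux.undec⟩
end

section
/- SLL translates into first-order logic: for every formula φ of L and every natural number n, there exists a first-order formula α(x₀,…,xₙ) in the first-order language with countably many unary predicates P_i (one per atom), two binary relation symbols R₁ and R₂, and equality, such that for every model M = (W,R₁,R₂,V) (viewed as a first-order structure in the obvious way) and every sequence S = ⟨w₀,…,wₙ⟩ with Set(S) ⊆ R₁: M,S ⊨ φ if and only if M ⊨ α[x₀:=w₀,…,xₙ:=wₙ]. -/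
attribute [local instance] Classical.propDecidable

open FirstOrder

/-- The first-order language with countably many unary predicates P_i, two
binary relation symbols (R₁ and R₂), and equality (built into FOL). -/
def sllLang : FirstOrder.Language where
  Functions := fun _ => Empty
  Relations := fun n =>
    match n with
    | 1 => ℕ
    | 2 => Fin 2
    | _ => Empty

/-- View an SLL-model as a first-order structure for `sllLang`. -/
def toStructure {W : Type} (M : SLLModel W) : sllLang.Structure W where
  funMap := fun {n} f _ => f.elim
  RelMap := fun {n} =>
    match n with
    | 0 => fun r _ => r.elim
    | 1 => fun i args => args 0 ∈ M.V i
    | 2 => fun (b : Fin 2) args =>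
        if b = 0 then (args 0, args 1) ∈ M.R1 else (args 0, args 1) ∈ M.R2
    | _ + 3 => fun r _ => r.elim

/-- First-order definable families of conditions on valuations, uniformly in the model. -/
def FODef (β : Type) (P : ∀ W : Type, SLLModel W → (β → W) → Prop) : Prop :=
  ∃ α : sllLang.Formula β, ∀ (W : Type) (M : SLLModel W) (v : β → W),
    P W M v ↔ (letI := toStructure M; α.Realize v)

theorem FODef.congr {β : Type} {P Q : ∀ W : Type, SLLModel W → (β → W) → Prop}
    (h : FODef β P) (hPQ : ∀ W M v, Q W M v ↔ P W M v) : FODef β Q := by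
  obtain ⟨α, hα⟩ := h
  exact ⟨α, fun W M v => (hPQ W M v).trans (hα W M v)⟩

theorem FODef.fnot {β : Type} {P : ∀ W : Type, SLLModel W → (β → W) → Prop}
    (h : FODef β P) : FODef β (fun W M v => ¬ P W M v) := by
  obtain ⟨α, hα⟩ := h
  refine ⟨∼α, fun W M v => ?_⟩
  exact not_congr (hα W M v)

theorem FODef.fand {β : Type} {P Q : ∀ W : Type, SLLModel W → (β → W) → Prop}
    (h : FODef β P) (h' : FODef β Q) : FODef β (fun W M v => P W M v ∧ Q W M v) := by
  obtain ⟨α, hα⟩ := h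
  obtain ⟨α', hα'⟩ := h'
  refine ⟨α ⊓ α', fun W M v => ?_⟩
  letI := toStructure M
  rw [FirstOrder.Language.Formula.realize_inf]
  exact and_congr (hα W M v) (hα' W M v)

theorem FODef.for' {β : Type} {P Q : ∀ W : Type, SLLModel W → (β → W) → Prop}
    (h : FODef β P) (h' : FODef β Q) : FODef β (fun W M v => P W M v ∨ Q W M v) :=
  (h.fnot.fand h'.fnot).fnot.congr (fun W M v => by tauto)

theorem FODef.false {β : Type} : FODef β (fun _ _ _ => False) :=
  ⟨⊥, fun W M v => Iff.rfl⟩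

theorem FODef.eq {β : Type} (a b : β) : FODef β (fun _ _ v => v a = v b) := by
  refine ⟨(FirstOrder.Language.Term.var a).equal (FirstOrder.Language.Term.var b),
    fun W M v => ?_⟩
  letI := toStructure M
  rw [FirstOrder.Language.Formula.realize_equal]
  exact Iff.rfl

theorem FODef.pred {β : Type} (i : ℕ) (a : β) : FODef β (fun _ M v => v a ∈ M.V i) :=
  ⟨FirstOrder.Language.Relations.formula (L := sllLang) (n := 1) (show sllLang.Relations 1 from i)
    (fun _ => FirstOrder.Language.Term.var a), fun W M v => Iff.rfl⟩

theorem FODef.r1 {β : Type} (a b : β) : FODef β (fun _ M v => (v a, v b) ∈ M.R1) :=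
  ⟨FirstOrder.Language.Relations.formula (L := sllLang) (n := 2)
    (show sllLang.Relations 2 from (0 : Fin 2))
    ![FirstOrder.Language.Term.var a, FirstOrder.Language.Term.var b], fun W M v => by
      letI := toStructure M
      rw [FirstOrder.Language.Formula.realize_rel]
      change _ ↔ (if (0 : Fin 2) = 0 then (v a, v b) ∈ M.R1 else (v a, v b) ∈ M.R2)
      simp⟩

theorem FODef.r2 {β : Type} (a b : β) : FODef β (fun _ M v => (v a, v b) ∈ M.R2) :=
  ⟨FirstOrder.Language.Relations.formula (L := sllLang) (n := 2)
    (show sllLang.Relations 2 from (1 : Fin 2))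
    ![FirstOrder.Language.Term.var a, FirstOrder.Language.Term.var b], fun W M v => by
      letI := toStructure M
      rw [FirstOrder.Language.Formula.realize_rel]
      change _ ↔ (if (1 : Fin 2) = 0 then (v a, v b) ∈ M.R1 else (v a, v b) ∈ M.R2)
      simp⟩

theorem FODef.ex {β γ : Type} [Finite γ] {P : ∀ W : Type, SLLModel W → (β ⊕ γ → W) → Prop}
    (h : FODef (β ⊕ γ) P) : FODef β (fun W M v => ∃ u : γ → W, P W M (Sum.elim v u)) := by
  obtain ⟨α, hα⟩ := h
  refine ⟨FirstOrder.Language.Formula.iExs γ α, fun W M v => ?_⟩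
  letI := toStructure M
  rw [FirstOrder.Language.Formula.realize_iExs]
  exact exists_congr fun u => hα W M _

theorem FODef.edges {β : Type} (a b : β) (h : List β) : ∀ w : β,
    FODef β (fun _ _ v => (v a, v b) ∈ edges (v w) (h.map v)) := by
  induction h with
  | nil => exact fun w => FODef.false.congr (fun W M v => by simp [_root_.edges])
  | cons y t ih =>
    intro w
    exact (((FODef.eq a y).fand (FODef.eq b w)).for' (ih y)).congr
      (fun W M v => by simp [_root_.edges])

theorem FODef.trunc {β : Type} (a b : β)
    (Q : ∀ W : Type, SLLModel W → (β → W) → W → List W → Prop)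
    (hQ : ∀ (w : β) (h : List β), FODef β (fun W M v => Q W M v (v w) (h.map v))) (h : List β) : ∀ w : β,
    FODef β (fun W M v => Q W M v (trunc (v a, v b) (v w) (h.map v)).1
      (trunc (v a, v b) (v w) (h.map v)).2) := by
  induction h with
  | nil => exact fun w => (hQ w []).congr (fun W M v => by simp [_root_.trunc])
  | cons y t ih =>
    intro w
    have h1 := FODef.edges a b t y
    have h2 := (FODef.eq y a).fand (FODef.eq w b)
    refine ((h1.fand (ih y)).for' (h1.fnot.fand
      ((h2.fand (hQ y t)).for' (h2.fnot.fand (hQ w (y :: t)))))).congr (fun W M v => ?_)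
    simp only [List.map_cons, _root_.trunc]
    by_cases c1 : (v a, v b) ∈ _root_.edges (v y) (t.map v)
    · simp [c1]
    · by_cases c2 : v y = v a ∧ v w = v b
      · have c1' := c1
        rw [c2.1] at c1'
        simp [c1', c2]
      · simp [c1, c2]

/-- Translation, relative to a definable update `R` of the relation `R₁`. -/
theorem FODef.sat (φ : Form) : ∀ (β : Type)
    (R : ∀ W : Type, SLLModel W → (β → W) → Set (W × W))
    (_ : ∀ (γ : Type) (f : β → γ) (a b : γ),
      FODef γ (fun W M v => (v a, v b) ∈ R W M (v ∘ f)))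
    (w : β) (h : List β),
    FODef β (fun W M v => Sat ⟨R W M v, M.R2, M.V⟩ φ (v w) (h.map v)) := by
  induction φ with
  | atom i =>
    intro β R hR w h
    exact (FODef.pred i w).congr (fun W M v => by simp [Sat])
  | neg φ ih =>
    intro β R hR w h
    exact (ih β R hR w h).fnot.congr (fun W M v => by simp [Sat])
  | and φ ψ ih1 ih2 =>
    intro β R hR w h
    exact ((ih1 β R hR w h).fand (ih2 β R hR w h)).congr (fun W M v => by simp [Sat])
  | dia φ ih =>
    intro β R hR w h
    have h1 := hR (β ⊕ Fin 1) Sum.inl (Sum.inl w) (Sum.inr 0)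
    have h2 := ih (β ⊕ Fin 1) (fun W M v => R W M (v ∘ Sum.inl))
      (fun γ f a b => hR γ (f ∘ Sum.inl) a b) (Sum.inr 0) ((w :: h).map Sum.inl)
    refine (h1.fand h2).ex.congr (fun W M v => ?_)
    simp only [Sat, Sum.elim_comp_inl, Sum.elim_inl, Sum.elim_inr, List.map_map, List.map_cons]
    exact ⟨fun ⟨x, hx⟩ => ⟨fun _ => x, hx⟩, fun ⟨u, hu⟩ => ⟨u 0, hu⟩⟩
  | rem1 φ ih =>
    intro β R hR w h
    have h1 := FODef.edges (β := β ⊕ Fin 2) (Sum.inr 0) (Sum.inr 1) (h.map Sum.inl) (Sum.inl w)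
    have h2 := (FODef.r2 (β := β ⊕ Fin 2) (Sum.inr 0) (Sum.inr 1)).fnot
    have h3 := FODef.trunc (β := β ⊕ Fin 2) (Sum.inr 0) (Sum.inr 1) _
      (ih (β ⊕ Fin 2) (fun W M v => R W M (v ∘ Sum.inl) \ {(v (Sum.inr 0), v (Sum.inr 1))})
        (fun γ f a b => ((hR γ (f ∘ Sum.inl) a b).fand
          ((FODef.eq a (f (Sum.inr 0))).fand (FODef.eq b (f (Sum.inr 1)))).fnot).congr
          (fun W M v => by simp [Function.comp_assoc])))
      (h.map Sum.inl) (Sum.inl w)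
    refine (h1.fand (h2.fand h3)).ex.congr (fun W M v => ?_)
    simp only [Sat, SLLModel.del, Sum.elim_comp_inl, Sum.elim_inl, Sum.elim_inr, List.map_map]
    exact ⟨fun ⟨e, he⟩ => ⟨![e.1, e.2], he⟩, fun ⟨u, hu⟩ => ⟨(u 0, u 1), hu⟩⟩
  | rem2 φ ih =>
    intro β R hR w h
    have h0 := hR (β ⊕ Fin 2) Sum.inl (Sum.inr 0) (Sum.inr 1)
    have h1 := (FODef.edges (β := β ⊕ Fin 2) (Sum.inr 0) (Sum.inr 1)
      (h.map Sum.inl) (Sum.inl w)).fnot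
    have h2 := (FODef.r2 (β := β ⊕ Fin 2) (Sum.inr 0) (Sum.inr 1)).fnot
    have h3 := ih (β ⊕ Fin 2)
        (fun W M v => R W M (v ∘ Sum.inl) \ {(v (Sum.inr 0), v (Sum.inr 1))})
        (fun γ f a b => ((hR γ (f ∘ Sum.inl) a b).fand
          ((FODef.eq a (f (Sum.inr 0))).fand (FODef.eq b (f (Sum.inr 1)))).fnot).congr
          (fun W M v => by simp [Function.comp_assoc]))
        (Sum.inl w) (h.map Sum.inl)
    refine (h0.fand (h2.fand (h1.fand h3))).ex.congr (fun W M v => ?_)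
    simp only [Sat, SLLModel.del, Sum.elim_comp_inl, Sum.elim_inl, Sum.elim_inr, List.map_map]
    exact ⟨fun ⟨e, he⟩ => ⟨![e.1, e.2], he⟩, fun ⟨u, hu⟩ => ⟨(u 0, u 1), hu⟩⟩
  | add φ ih =>
    intro β R hR w h
    have h0 := (hR (β ⊕ Fin 2) Sum.inl (Sum.inr 0) (Sum.inr 1)).fnot
    have h2 := FODef.r2 (β := β ⊕ Fin 2) (Sum.inr 0) (Sum.inr 1)
    have h3 := ih (β ⊕ Fin 2)
        (fun W M v => insert (v (Sum.inr 0), v (Sum.inr 1)) (R W M (v ∘ Sum.inl)))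
        (fun γ f a b => (((FODef.eq a (f (Sum.inr 0))).fand (FODef.eq b (f (Sum.inr 1)))).for'
          (hR γ (f ∘ Sum.inl) a b)).congr
          (fun W M v => by simp [Function.comp_assoc]))
        (Sum.inl w) (h.map Sum.inl)
    refine (h2.fand (h0.fand h3)).ex.congr (fun W M v => ?_)
    simp only [Sat, SLLModel.addE, Sum.elim_comp_inl, Sum.elim_inl, Sum.elim_inr, List.map_map]
    exact ⟨fun ⟨e, he⟩ => ⟨![e.1, e.2], he⟩, fun ⟨u, hu⟩ => ⟨(u 0, u 1), hu⟩⟩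

/-- SLL translates into first-order logic: for every φ ∈ L and every n there is a
first-order formula α(x₀,…,xₙ) over `sllLang` such that for every model M and
every sequence S = ⟨w₀,…,wₙ⟩ with Set(S) ⊆ R₁: M,S ⊨ φ iff M ⊨ α[x₀:=w₀,…,xₙ:=wₙ]. -/
theorem sll_fo_translation (φ : Form) (n : ℕ) :
    ∃ α : sllLang.Formula (Fin (n + 1)),
      ∀ (W : Type) (M : SLLModel W) (v : Fin (n + 1) → W),
        (∀ i : Fin n, (v i.castSucc, v i.succ) ∈ M.R1) →
        (Sat M φ (v (Fin.last n)) (((List.finRange n).map fun i => v i.castSucc).reverse) ↔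
          (letI := toStructure M; α.Realize v)) := by
  obtain ⟨α, hα⟩ := FODef.sat φ (Fin (n + 1)) (fun _ M _ => M.R1)
    (fun γ f a b => FODef.r1 a b) (Fin.last n) (((List.finRange n).map Fin.castSucc).reverse)
  refine ⟨α, fun W M v _ => ?_⟩
  rw [← hα W M v]
  beta_reduce
  rw [List.map_reverse, List.map_map]
  exact Iff.rfl
end
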